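/- arXiv:2602.20367 — 3 statements merged into one kernel-verified Lean document; each statement's English description precedes it below -/
import Mathlib

section
/- Let n ≥ 1 and let Q denote the quotient of ℂⁿ ∖ {0} by the action of {±1} via scalar multiplication, equipped with the quotient topology; coordinatewise complex conjugation on ℂⁿ ∖ {0} descends to a continuous involution c on Q. Then the fixed-point set of c equals the image in Q of (ℝⁿ ∖ {0}) ∪ (i·ℝⁿ ∖ {0}); equivalently, for a nonzero vector v ∈ ℂⁿ one has conj(v) ∈ {v, −v} if and only if every coordinate of v is real or every coordinate of v is purely imaginary. Moreover, if n ≥ 2, this fixed-point set has exactly two connected components, namely the images of ℝⁿ ∖ {0} and of i·(ℝⁿ ∖ {0}). -/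
open scoped ComplexConjugate

/-- Nonzero vectors in `ℂⁿ`. -/
abbrev NonzeroVec (n : ℕ) : Type := {v : Fin n → ℂ // v ≠ 0}

/-- The setoid identifying `v` with `-v` (the action of `{±1}` by scalar
multiplication). -/
def pmSetoid (n : ℕ) : Setoid (NonzeroVec n) where
  r v w := w.1 = v.1 ∨ w.1 = -v.1
  iseqv := by
    refine ⟨fun v => Or.inl rfl, ?_, ?_⟩
    · rintro v w (h | h)
      · exact Or.inl h.symm
      · exact Or.inr (by rw [h, neg_neg])
    · rintro u v w (h | h) (h' | h')
      · exact Or.inl (h'.trans h)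
      · exact Or.inr (by rw [h', h])
      · exact Or.inr (h'.trans h)
      · exact Or.inl (by rw [h', h, neg_neg])

/-- The quotient `(ℂⁿ ∖ {0})/{±1}`, with the quotient topology. -/
abbrev PmQuot (n : ℕ) : Type := Quotient (pmSetoid n)

/-- Coordinatewise complex conjugation on nonzero vectors. -/
def conjVec (n : ℕ) (v : NonzeroVec n) : NonzeroVec n :=
  ⟨fun i => star (v.1 i), by
    intro h
    apply v.2
    funext i
    have := congrFun h i
    simpa using this⟩

/-- Coordinatewise complex conjugation descends to the quotient `(ℂⁿ ∖ {0})/{±1}`. -/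
def conjQuot (n : ℕ) : PmQuot n → PmQuot n :=
  Quotient.map (conjVec n) (by
    rintro v w (h | h)
    · exact Or.inl (by funext i; simp [conjVec, h])
    · exact Or.inr (by funext i; simp [conjVec, h]))

/-- In a union of two disjoint closed preconnected sets, the component of a point of the first
set is the first set. -/
theorem connectedComponentIn_union_eq_left {X : Type*} [TopologicalSpace X] {A B : Set X}
    (hA : IsClosed A) (hB : IsClosed B) (hAc : IsPreconnected A) (hAB : A ∩ B = ∅) {q : X}
    (hq : q ∈ A) : connectedComponentIn (A ∪ B) q = A := by
  refine Set.Subset.antisymm ?_ (hAc.subset_connectedComponentIn hq Set.subset_union_left)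
  have hmem : q ∈ connectedComponentIn (A ∪ B) q := mem_connectedComponentIn (Or.inl hq)
  rcases (isPreconnected_iff_subset_of_disjoint_closed.1 isPreconnected_connectedComponentIn)
    A B hA hB (connectedComponentIn_subset _ _) (by rw [hAB, Set.inter_empty]) with h | h
  · exact h
  · have hqB : q ∈ A ∩ B := ⟨hq, h hmem⟩
    simp [hAB] at hqB

theorem mk_eq_mk_iff {n : ℕ} {v w : NonzeroVec n} :
    Quotient.mk (pmSetoid n) v = Quotient.mk (pmSetoid n) w ↔ w.1 = v.1 ∨ w.1 = -v.1 :=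
  Quotient.eq

theorem continuous_conjVec (n : ℕ) : Continuous (conjVec n) :=
  Continuous.subtype_mk (continuous_pi fun i =>
    ((continuous_apply i).comp continuous_subtype_val).star) _

theorem conj_eq_self_or_neg_iff {n : ℕ} (v : Fin n → ℂ) :
    ((fun i => star (v i)) = v ∨ (fun i => star (v i)) = -v) ↔
      ((∀ i, (v i).im = 0) ∨ (∀ i, (v i).re = 0)) := by
  simp only [funext_iff, Complex.ext_iff, Complex.star_def, Complex.conj_re, Complex.conj_im,
    Pi.neg_apply, Complex.neg_re, Complex.neg_im, true_and, and_true, neg_eq_self, self_eq_neg]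

/-- The image in the quotient of a closed set stable under negation is closed. -/
theorem isClosed_image_mk {n : ℕ} {S : Set (NonzeroVec n)} (hS : IsClosed S)
    (hneg : ∀ v w : NonzeroVec n, w.1 = -v.1 → v ∈ S → w ∈ S) :
    IsClosed (Quotient.mk (pmSetoid n) '' S) := by
  refine isQuotientMap_quotient_mk'.isClosed_preimage.1 ?_
  convert hS using 1
  ext w
  constructor
  · rintro ⟨v, hv, hvw⟩
    rcases mk_eq_mk_iff.1 hvw with h | h
    · rwa [Subtype.ext h]
    · exact hneg v w h hv
  · exact fun hw => ⟨w, hw, rfl⟩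

/-- For `n ≥ 2`, the nonzero vectors in the real form `t·ℝⁿ` of `ℂⁿ` form a connected set. -/
theorem isConnected_setOf_real_form {n : ℕ} (hn : 2 ≤ n) {t : ℂ} (ht : t ≠ 0) :
    IsConnected {v : NonzeroVec n | ∃ x : Fin n → ℝ, ∀ i, v.1 i = t * x i} := by
  have hrank : 1 < Module.rank ℝ (Fin n → ℝ) := by
    rw [rank_fin_fun]
    exact_mod_cast hn
  have hconn := isConnected_iff_connectedSpace.1
    (isConnected_compl_singleton_of_one_lt_rank hrank (0 : Fin n → ℝ))
  let f : ({0}ᶜ : Set (Fin n → ℝ)) → NonzeroVec n := fun x =>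
    ⟨fun i => t * x.1 i, fun h => x.2 (funext fun i => by simpa [ht] using congrFun h i)⟩
  have hf : Continuous f :=
    Continuous.subtype_mk (continuous_pi fun i => continuous_const.mul
      (Complex.continuous_ofReal.comp ((continuous_apply i).comp continuous_subtype_val))) _
  convert isConnected_range hf using 1
  ext v
  constructor
  · rintro ⟨x, hx⟩
    refine ⟨⟨x, fun h => v.2 (funext fun i => ?_)⟩, Subtype.ext (funext fun i => (hx i).symm)⟩
    simp [hx, show x = 0 from h]
  · rintro ⟨x, rfl⟩
    exact ⟨x.1, fun i => rfl⟩

theorem isConnected_setOf_im_eq_zero {n : ℕ} (hn : 2 ≤ n) :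
    IsConnected {v : NonzeroVec n | ∀ i, (v.1 i).im = 0} := by
  convert isConnected_setOf_real_form hn one_ne_zero using 1
  ext v
  constructor
  · exact fun h => ⟨fun i => (v.1 i).re, fun i => by simp [Complex.ext_iff, h i]⟩
  · rintro ⟨x, hx⟩ i
    simp [hx]

theorem isConnected_setOf_re_eq_zero {n : ℕ} (hn : 2 ≤ n) :
    IsConnected {v : NonzeroVec n | ∀ i, (v.1 i).re = 0} := by
  convert isConnected_setOf_real_form hn Complex.I_ne_zero using 1
  ext v
  constructor
  · exact fun h => ⟨fun i => (v.1 i).im, fun i => by simp [Complex.ext_iff, h i]⟩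
  · rintro ⟨x, hx⟩ i
    simp [hx]

theorem isClosed_image_setOf_im_eq_zero (n : ℕ) :
    IsClosed (Quotient.mk (pmSetoid n) '' {v : NonzeroVec n | ∀ i, (v.1 i).im = 0}) := by
  refine isClosed_image_mk ?_ fun v w h hv i => by simpa [h] using hv i
  simp only [Set.ofPred_forall]
  exact isClosed_iInter fun i => isClosed_eq
    (Complex.continuous_im.comp ((continuous_apply i).comp continuous_subtype_val))
    continuous_const

theorem isClosed_image_setOf_re_eq_zero (n : ℕ) :
    IsClosed (Quotient.mk (pmSetoid n) '' {v : NonzeroVec n | ∀ i, (v.1 i).re = 0}) := by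
  refine isClosed_image_mk ?_ fun v w h hv i => by simpa [h] using hv i
  simp only [Set.ofPred_forall]
  exact isClosed_iInter fun i => isClosed_eq
    (Complex.continuous_re.comp ((continuous_apply i).comp continuous_subtype_val))
    continuous_const

theorem image_im_inter_image_re_eq_empty (n : ℕ) :
    (Quotient.mk (pmSetoid n) '' {v : NonzeroVec n | ∀ i, (v.1 i).im = 0}) ∩
      (Quotient.mk (pmSetoid n) '' {v : NonzeroVec n | ∀ i, (v.1 i).re = 0}) = ∅ := by
  rw [Set.eq_empty_iff_forall_notMem]
  rintro _ ⟨⟨v, hv, rfl⟩, w, hw, hwv⟩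
  refine v.2 (funext fun i => Complex.ext ?_ (hv i))
  rcases mk_eq_mk_iff.1 hwv with h | h <;> simpa [h] using hw i

theorem setOf_conjQuot_eq_self (n : ℕ) :
    {q : PmQuot n | conjQuot n q = q} =
      Quotient.mk (pmSetoid n) ''
        ({v : NonzeroVec n | ∀ i, (v.1 i).im = 0} ∪
          {v : NonzeroVec n | ∀ i, (v.1 i).re = 0}) := by
  have key (v : NonzeroVec n) : conjQuot n (Quotient.mk (pmSetoid n) v) =
      Quotient.mk (pmSetoid n) v ↔ (∀ i, (v.1 i).im = 0) ∨ (∀ i, (v.1 i).re = 0) := by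
    rw [← conj_eq_self_or_neg_iff]
    exact eq_comm.trans mk_eq_mk_iff
  ext q
  constructor
  · induction q using Quotient.inductionOn with
    | h v => exact fun h => ⟨v, (key v).1 h, rfl⟩
  · rintro ⟨v, hv, rfl⟩
    exact (key v).2 hv

/-- Let `n ≥ 1` and let `Q = (ℂⁿ ∖ {0})/{±1}` with the quotient
topology. Coordinatewise complex conjugation descends to a continuous involution `c` on
`Q`. The fixed-point set of `c` equals the image in `Q` of `(ℝⁿ ∖ {0}) ∪ i·(ℝⁿ ∖ {0})`;
equivalently, for a nonzero `v ∈ ℂⁿ`, `conj v ∈ {v, −v}` iff all coordinates of `v` are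
real or all are purely imaginary. Moreover, if `n ≥ 2`, the fixed-point set has exactly
two connected components, namely the images of `ℝⁿ ∖ {0}` and of `i·(ℝⁿ ∖ {0})`. -/
theorem conj_fixed_points_of_pm_quotient (n : ℕ) (hn : 1 ≤ n) :
    -- `c` is the descent of coordinatewise conjugation, it is continuous and involutive
    (∀ v : NonzeroVec n,
      conjQuot n (Quotient.mk (pmSetoid n) v) = Quotient.mk (pmSetoid n) (conjVec n v)) ∧
    Continuous (conjQuot n) ∧
    (∀ q : PmQuot n, conjQuot n (conjQuot n q) = q) ∧
    -- the fixed-point set is the image of real and purely imaginary vectors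
    ({q : PmQuot n | conjQuot n q = q} =
      Quotient.mk (pmSetoid n) ''
        ({v : NonzeroVec n | ∀ i, (v.1 i).im = 0} ∪
          {v : NonzeroVec n | ∀ i, (v.1 i).re = 0})) ∧
    -- equivalently, for nonzero `v`: `conj v ∈ {v, -v}` iff `v` is real or imaginary
    (∀ v : Fin n → ℂ, v ≠ 0 →
      (((fun i => star (v i)) = v ∨ (fun i => star (v i)) = -v) ↔
        ((∀ i, (v i).im = 0) ∨ (∀ i, (v i).re = 0)))) ∧
    -- for `n ≥ 2`, the fixed locus has exactly two connected components,
    -- the images `A` of `ℝⁿ ∖ {0}` and `B` of `i·(ℝⁿ ∖ {0})`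
    (2 ≤ n →
      (Quotient.mk (pmSetoid n) '' {v : NonzeroVec n | ∀ i, (v.1 i).im = 0}).Nonempty ∧
      (Quotient.mk (pmSetoid n) '' {v : NonzeroVec n | ∀ i, (v.1 i).re = 0}).Nonempty ∧
      (Quotient.mk (pmSetoid n) '' {v : NonzeroVec n | ∀ i, (v.1 i).im = 0}) ∩
        (Quotient.mk (pmSetoid n) '' {v : NonzeroVec n | ∀ i, (v.1 i).re = 0}) = ∅ ∧
      (∀ q ∈ {q : PmQuot n | conjQuot n q = q},
        connectedComponentIn {q : PmQuot n | conjQuot n q = q} q =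
            Quotient.mk (pmSetoid n) '' {v : NonzeroVec n | ∀ i, (v.1 i).im = 0} ∨
        connectedComponentIn {q : PmQuot n | conjQuot n q = q} q =
            Quotient.mk (pmSetoid n) '' {v : NonzeroVec n | ∀ i, (v.1 i).re = 0})) := by
  refine ⟨fun _ => rfl, (continuous_conjVec n).quotient_map' _, ?_, setOf_conjQuot_eq_self n,
    fun v _ => conj_eq_self_or_neg_iff v, fun h2 => ?_⟩
  · intro q
    induction q using Quotient.inductionOn with
    | h v =>
      exact congrArg (Quotient.mk (pmSetoid n)) (Subtype.ext (funext fun i => star_star (v.1 i)))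
  · have hre := isConnected_setOf_im_eq_zero h2
    have him := isConnected_setOf_re_eq_zero h2
    have hdisj := image_im_inter_image_re_eq_empty n
    refine ⟨hre.nonempty.image _, him.nonempty.image _, hdisj, ?_⟩
    rw [setOf_conjQuot_eq_self, Set.image_union]
    rintro q (hq | hq)
    · exact Or.inl (connectedComponentIn_union_eq_left (isClosed_image_setOf_im_eq_zero n)
        (isClosed_image_setOf_re_eq_zero n)
        (hre.isPreconnected.image _ continuous_quotient_mk'.continuousOn) hdisj hq)
    · rw [Set.union_comm]
      exact Or.inr (connectedComponentIn_union_eq_left (isClosed_image_setOf_re_eq_zero n)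
        (isClosed_image_setOf_im_eq_zero n)
        (him.isPreconnected.image _ continuous_quotient_mk'.continuousOn)
        (by rwa [Set.inter_comm]) hq)
end

section
/- Let N ≤ SL₂(ℂ) be the subgroup of diagonal and antidiagonal matrices, with σ the involutive automorphism given by entrywise complex conjugation. Then the σ-twisted conjugation action of N on the 1-cocycle set {g ∈ N | g * σ(g) = 1} (via h • g = σ(h) * g * h⁻¹ for h ∈ N) has exactly two orbits, represented by the identity matrix and by the antidiagonal matrix with rows (0, i) and (i, 0). -/
/-- `SL₂(ℂ)`. -/
abbrev SL2C : Type := Matrix.SpecialLinearGroup (Fin 2) ℂ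

/-- Entrywise complex conjugation on `SL₂(ℂ)` (an involutive group automorphism). -/
def conjSL (A : SL2C) : SL2C :=
  ⟨A.1.map (star : ℂ → ℂ), by
    have h : (A.1.map (star : ℂ → ℂ)).det = star A.1.det := by
      simpa [starRingEnd_apply] using (RingHom.map_det (starRingEnd ℂ) A.1).symm
    rw [h, A.2, star_one]⟩

/-- The subgroup `N ≤ SL₂(ℂ)` of diagonal matrices `diag(z, z⁻¹)` and antidiagonal
matrices with rows `(0, t)`, `(−t⁻¹, 0)` — the normalizer of the diagonal torus. -/
def torusNormalizer : Subgroup SL2C where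
  carrier := {A | (A.1 0 1 = 0 ∧ A.1 1 0 = 0) ∨ (A.1 0 0 = 0 ∧ A.1 1 1 = 0)}
  one_mem' := by
    left
    constructor <;> simp [Matrix.SpecialLinearGroup.coe_one, Matrix.one_apply]
  mul_mem' := by
    rintro A B (⟨ha1, ha2⟩ | ⟨ha1, ha2⟩) (⟨hb1, hb2⟩ | ⟨hb1, hb2⟩)
    · left; constructor <;>
        simp [Matrix.SpecialLinearGroup.coe_mul, Matrix.mul_apply, Fin.sum_univ_two,
          ha1, ha2, hb1, hb2]
    · right; constructor <;>
        simp [Matrix.SpecialLinearGroup.coe_mul, Matrix.mul_apply, Fin.sum_univ_two,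
          ha1, ha2, hb1, hb2]
    · right; constructor <;>
        simp [Matrix.SpecialLinearGroup.coe_mul, Matrix.mul_apply, Fin.sum_univ_two,
          ha1, ha2, hb1, hb2]
    · left; constructor <;>
        simp [Matrix.SpecialLinearGroup.coe_mul, Matrix.mul_apply, Fin.sum_univ_two,
          ha1, ha2, hb1, hb2]
  inv_mem' := by
    rintro A (⟨ha1, ha2⟩ | ⟨ha1, ha2⟩)
    · left; constructor <;>
        simp [Matrix.SpecialLinearGroup.coe_inv, Matrix.adjugate_fin_two, ha1, ha2]
    · right; constructor <;>
        simp [Matrix.SpecialLinearGroup.coe_inv, Matrix.adjugate_fin_two, ha1, ha2]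

/-- The antidiagonal matrix with rows `(0, i)` and `(i, 0)`, an element of `SL₂(ℂ)`. -/
def Jmat : SL2C :=
  ⟨!![0, Complex.I; Complex.I, 0], by
    simp [Matrix.det_fin_two_of, Complex.I_mul_I]⟩

open ComplexConjugate

/-- The diagonal matrix `diag(z, z⁻¹)` in `SL₂(ℂ)`. -/
noncomputable def diagSL (z : ℂ) (hz : z ≠ 0) : SL2C :=
  ⟨!![z, 0; 0, z⁻¹], by simp [Matrix.det_fin_two_of, hz]⟩

/-- The antidiagonal matrix with rows `(0, t)` and `(-t⁻¹, 0)` in `SL₂(ℂ)`. -/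
noncomputable def antidiagSL (t : ℂ) (ht : t ≠ 0) : SL2C :=
  ⟨!![0, t; -t⁻¹, 0], by simp [Matrix.det_fin_two_of, ht]⟩

lemma diagSL_mem (z : ℂ) (hz : z ≠ 0) : diagSL z hz ∈ torusNormalizer :=
  Or.inl (by simp [diagSL])

lemma antidiagSL_mem (t : ℂ) (ht : t ≠ 0) : antidiagSL t ht ∈ torusNormalizer :=
  Or.inr (by simp [antidiagSL])

lemma Jmat_eq_antidiagSL : Jmat = antidiagSL Complex.I Complex.I_ne_zero := by
  ext i j
  fin_cases i <;> fin_cases j <;> simp [Jmat, antidiagSL]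

lemma conjSL_diagSL (z : ℂ) (hz : z ≠ 0) :
    conjSL (diagSL z hz) = diagSL (conj z) (by simpa using hz) := by
  ext i j
  fin_cases i <;> fin_cases j <;> simp [conjSL, diagSL]

lemma conjSL_antidiagSL (t : ℂ) (ht : t ≠ 0) :
    conjSL (antidiagSL t ht) = antidiagSL (conj t) (by simpa using ht) := by
  ext i j
  fin_cases i <;> fin_cases j <;> simp [conjSL, antidiagSL]

lemma diagSL_mul_diagSL (z w : ℂ) (hz : z ≠ 0) (hw : w ≠ 0) :
    diagSL z hz * diagSL w hw = diagSL (z * w) (mul_ne_zero hz hw) := by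
  ext i j
  rw [Matrix.SpecialLinearGroup.coe_mul]
  fin_cases i <;> fin_cases j <;> simp [diagSL, mul_comm]

lemma diagSL_mul_antidiagSL (z t : ℂ) (hz : z ≠ 0) (ht : t ≠ 0) :
    diagSL z hz * antidiagSL t ht = antidiagSL (z * t) (mul_ne_zero hz ht) := by
  ext i j
  rw [Matrix.SpecialLinearGroup.coe_mul]
  fin_cases i <;> fin_cases j <;> simp [diagSL, antidiagSL, mul_comm]

lemma antidiagSL_mul_diagSL (t z : ℂ) (ht : t ≠ 0) (hz : z ≠ 0) :
    antidiagSL t ht * diagSL z hz = antidiagSL (t / z) (div_ne_zero ht hz) := by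
  ext i j
  rw [Matrix.SpecialLinearGroup.coe_mul]
  fin_cases i <;> fin_cases j <;> simp [diagSL, antidiagSL] <;> field_simp

lemma antidiagSL_mul_antidiagSL (t u : ℂ) (ht : t ≠ 0) (hu : u ≠ 0) :
    antidiagSL t ht * antidiagSL u hu =
      diagSL (-(t / u)) (neg_ne_zero.mpr (div_ne_zero ht hu)) := by
  ext i j
  rw [Matrix.SpecialLinearGroup.coe_mul]
  fin_cases i <;> fin_cases j <;> simp [diagSL, antidiagSL] <;> field_simp

lemma diagSL_eq_one_iff (z : ℂ) (hz : z ≠ 0) : diagSL z hz = 1 ↔ z = 1 := by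
  constructor
  · intro h
    simpa [diagSL] using congrArg (fun A : SL2C => A.1 0 0) h
  · rintro rfl
    ext i j
    fin_cases i <;> fin_cases j <;> simp [diagSL]

lemma antidiagSL_congr {t u : ℂ} (ht : t ≠ 0) (hu : u ≠ 0) (h : t = u) :
    antidiagSL t ht = antidiagSL u hu := by
  subst h; rfl

lemma diagSL_ne_antidiagSL (z t : ℂ) (hz : z ≠ 0) (ht : t ≠ 0) :
    diagSL z hz ≠ antidiagSL t ht := fun h =>
  hz (by simpa [diagSL, antidiagSL] using congrArg (fun A : SL2C => A.1 0 0) h)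

lemma mem_torusNormalizer_cases {g : SL2C} (hg : g ∈ torusNormalizer) :
    (∃ z hz, g = diagSL z hz) ∨ ∃ t ht, g = antidiagSL t ht := by
  have hdet := g.2
  rw [Matrix.det_fin_two] at hdet
  rcases hg with ⟨h01, h10⟩ | ⟨h00, h11⟩
  · rw [h01, zero_mul, sub_zero] at hdet
    refine Or.inl ⟨g.1 0 0, left_ne_zero_of_mul_eq_one hdet, ?_⟩
    ext i j
    fin_cases i <;> fin_cases j
    · simp [diagSL]
    · simpa [diagSL] using h01
    · simpa [diagSL] using h10
    · simpa [diagSL] using eq_inv_of_mul_eq_one_right hdet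
  · rw [h00, zero_mul, zero_sub, ← mul_neg] at hdet
    refine Or.inr ⟨g.1 0 1, left_ne_zero_of_mul_eq_one hdet, ?_⟩
    ext i j
    fin_cases i <;> fin_cases j
    · simpa [antidiagSL] using h00
    · simp [antidiagSL]
    · simpa [antidiagSL] using neg_eq_iff_eq_neg.mp (eq_inv_of_mul_eq_one_right hdet)
    · simpa [antidiagSL] using h11

lemma diagSL_cocycle_twisted_conj_one (z : ℂ) (hz : z ≠ 0)
    (hc : diagSL z hz * conjSL (diagSL z hz) = 1) :
    ∃ h ∈ torusNormalizer, conjSL h * diagSL z hz * h⁻¹ = 1 := by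
  rw [conjSL_diagSL, diagSL_mul_diagSL, diagSL_eq_one_iff, Complex.mul_conj'] at hc
  obtain ⟨w, rfl⟩ := IsAlgClosed.exists_pow_nat_eq z two_pos
  have hw : w ≠ 0 := by rintro rfl; simp at hz
  have hnorm : ‖w‖ = 1 := by
    have hsq : ‖w ^ 2‖ ^ 2 = 1 := by exact_mod_cast hc
    rw [norm_pow, ← pow_mul] at hsq
    exact (pow_eq_one_iff_of_nonneg (norm_nonneg w) (by norm_num)).mp hsq
  refine ⟨diagSL w hw, diagSL_mem w hw, ?_⟩
  rw [mul_inv_eq_one, conjSL_diagSL, diagSL_mul_diagSL]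
  congr 1
  rw [pow_two, ← mul_assoc, Complex.conj_mul', hnorm]
  simp

lemma antidiagSL_cocycle_twisted_conj_Jmat (t : ℂ) (ht : t ≠ 0)
    (hc : antidiagSL t ht * conjSL (antidiagSL t ht) = 1) :
    ∃ h ∈ torusNormalizer, conjSL h * antidiagSL t ht * h⁻¹ = Jmat := by
  have htc : conj t ≠ 0 := by simpa using ht
  rw [conjSL_antidiagSL, antidiagSL_mul_antidiagSL, diagSL_eq_one_iff, neg_eq_iff_eq_neg,
    div_eq_iff htc] at hc
  obtain ⟨r, rfl⟩ : ∃ r : ℝ, t = r * Complex.I := by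
    refine ⟨t.im, Complex.ext ?_ (by simp)⟩
    have hre := congrArg Complex.re hc
    simp at hre ⊢
    linarith
  have hr : r ≠ 0 := by rintro rfl; simp at ht
  rw [Jmat_eq_antidiagSL]
  rcases lt_or_gt_of_ne hr with hneg | hpos
  · have hs : (√(-r) : ℂ) ≠ 0 := by exact_mod_cast (Real.sqrt_pos.mpr (neg_pos.mpr hneg)).ne'
    have hsq : (√(-r) : ℂ) * √(-r) = -r := by
      exact_mod_cast Real.mul_self_sqrt (neg_pos.mpr hneg).le
    refine ⟨antidiagSL _ hs, antidiagSL_mem _ hs, ?_⟩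
    rw [mul_inv_eq_iff_eq_mul, conjSL_antidiagSL, antidiagSL_mul_antidiagSL,
      antidiagSL_mul_antidiagSL]
    congr 2
    rw [Complex.conj_ofReal, div_eq_div_iff ht hs, hsq]
    linear_combination (-r : ℂ) * Complex.I_mul_I
  · have hs : (√r : ℂ) ≠ 0 := by exact_mod_cast (Real.sqrt_pos.mpr hpos).ne'
    have hsq : (√r : ℂ) * √r = r := by exact_mod_cast Real.mul_self_sqrt hpos.le
    have hsi : (√r : ℂ)⁻¹ ≠ 0 := inv_ne_zero hs
    refine ⟨diagSL _ hsi, diagSL_mem _ hsi, ?_⟩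
    rw [mul_inv_eq_iff_eq_mul, conjSL_diagSL, diagSL_mul_antidiagSL, antidiagSL_mul_diagSL]
    apply antidiagSL_congr
    rw [map_inv₀, Complex.conj_ofReal, div_inv_eq_mul, inv_mul_eq_iff_eq_mul₀ hs, ← hsq]
    ring

lemma not_twisted_conj_one_Jmat :
    ¬ ∃ h ∈ torusNormalizer, conjSL h * (1 : SL2C) * h⁻¹ = Jmat := by
  rintro ⟨h, hh, heq⟩
  rw [mul_one, mul_inv_eq_iff_eq_mul, Jmat_eq_antidiagSL] at heq
  rcases mem_torusNormalizer_cases hh with ⟨z, hz, rfl⟩ | ⟨t, ht, rfl⟩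
  · rw [conjSL_diagSL, antidiagSL_mul_diagSL] at heq
    exact diagSL_ne_antidiagSL _ _ _ _ heq
  · rw [conjSL_antidiagSL, antidiagSL_mul_antidiagSL] at heq
    exact diagSL_ne_antidiagSL _ _ _ _ heq.symm


/-- The σ-twisted conjugation action `h • g = σ(h) * g * h⁻¹` of `N`
on the set of 1-cocycles `{g ∈ N | g * σ(g) = 1}` has exactly two orbits, represented by
the identity matrix and by the antidiagonal matrix `J` with rows `(0, i)`, `(i, 0)`:
every cocycle is twisted-conjugate to `1` or to `J`, both `1` and `J` are cocycles, and
`1` and `J` are not twisted-conjugate. -/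
theorem normalizer_twisted_orbits :
    ((1 : SL2C) ∈ torusNormalizer ∧ (1 : SL2C) * conjSL 1 = 1) ∧
    (Jmat ∈ torusNormalizer ∧ Jmat * conjSL Jmat = 1) ∧
    (∀ g : SL2C, g ∈ torusNormalizer → g * conjSL g = 1 →
      (∃ h ∈ torusNormalizer, conjSL h * g * h⁻¹ = 1) ∨
      (∃ h ∈ torusNormalizer, conjSL h * g * h⁻¹ = Jmat)) ∧
    ¬ ∃ h ∈ torusNormalizer, conjSL h * (1 : SL2C) * h⁻¹ = Jmat := by
  refine ⟨⟨one_mem _, ?_⟩, ⟨?_, ?_⟩, ?_, not_twisted_conj_one_Jmat⟩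
  · rw [one_mul]
    ext i j
    fin_cases i <;> fin_cases j <;> simp [conjSL]
  · rw [Jmat_eq_antidiagSL]
    exact antidiagSL_mem _ _
  · rw [Jmat_eq_antidiagSL, conjSL_antidiagSL, antidiagSL_mul_antidiagSL, diagSL_eq_one_iff]
    simp
  · intro g hg hc
    rcases mem_torusNormalizer_cases hg with ⟨z, hz, rfl⟩ | ⟨t, ht, rfl⟩
    · exact Or.inl (diagSL_cocycle_twisted_conj_one z hz hc)
    · exact Or.inr (antidiagSL_cocycle_twisted_conj_Jmat t ht hc)
end

section
/- Let n ≥ 1 and let O(n,ℂ) = {A ∈ Mat_n(ℂ) : Aᵀ A = 1ₙ}. For every A ∈ O(n,ℂ) satisfying the cocycle condition A · conj(A) = 1ₙ (where conj denotes entrywise complex conjugation), there exist natural numbers p, q with p + q = n and a matrix h ∈ O(n,ℂ) such that conj(h) · A · h⁻¹ = diag(1_p, −1_q); moreover the pair (p, q) is uniquely determined by A, so the matrices diag(1_p, −1_q), p + q = n, represent bijectively the orbits of the twisted conjugation action h • A = conj(h) · A · h⁻¹ of O(n,ℂ) on the set of such cocycles. -/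
open Matrix

/-- The diagonal matrix `diag(1_p, −1_q)` (with `p` ones followed by `−1`s). -/
def signatureMatrix (n p : ℕ) : Matrix (Fin n) (Fin n) ℂ :=
  Matrix.diagonal (fun i => if (i : ℕ) < p then (1 : ℂ) else -1)

theorem exists_perm_signature {n : ℕ} (P : Fin n → Prop) :
    ∃ p : ℕ, p ≤ n ∧ ∃ e : Equiv.Perm (Fin n), ∀ i, P (e i) ↔ (i : ℕ) < p := by
  classical
  have hp : Fintype.card {i // P i} ≤ n := by
    simpa using Fintype.card_subtype_le P
  refine ⟨Fintype.card {i // P i}, hp, ?_⟩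
  have hc : Fintype.card {i : Fin n // (i : ℕ) < Fintype.card {i // P i}} =
      Fintype.card {i // P i} := by
    rw [Fintype.card_subtype, Fin.card_filter_val_lt, min_eq_right hp]
  let f := Fintype.equivOfCardEq hc
  refine ⟨f.extendSubtype, fun i => ⟨fun h => ?_, fun h => f.extendSubtype_mem i h⟩⟩
  by_contra hi
  exact f.extendSubtype_not_mem i hi h

/-- An invertible real symmetric matrix is congruent to some `signatureMatrix`. -/
theorem exists_congr_signatureMatrix {n : ℕ} (Q : Matrix (Fin n) (Fin n) ℝ) (hQ : Qᵀ = Q)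
    (hu : IsUnit Q) :
    ∃ p ≤ n, ∃ R : Matrix (Fin n) (Fin n) ℝ,
      (Rᵀ * Q * R).map (algebraMap ℝ ℂ) = signatureMatrix n p := by
  have hH : Q.IsHermitian := by rw [IsHermitian, conjTranspose_eq_transpose_of_trivial, hQ]
  have hne (i) : hH.eigenvalues i ≠ 0 := by
    have hd : Q.det ≠ 0 := ((isUnit_iff_isUnit_det Q).1 hu).ne_zero
    rw [hH.det_eq_prod_eigenvalues] at hd
    exact Finset.prod_ne_zero_iff.1 (by exact_mod_cast hd) i (Finset.mem_univ i)
  obtain ⟨p, hp, e, he⟩ := exists_perm_signature fun i => 0 < hH.eigenvalues i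
  let U : Matrix (Fin n) (Fin n) ℝ := hH.eigenvectorUnitary
  have hU : Uᵀ * Q * U = diagonal hH.eigenvalues := by
    have := hH.conjStarAlgAut_star_eigenvectorUnitary
    simpa [Unitary.conjStarAlgAut_apply, star_eq_conjTranspose, U,
      conjTranspose_eq_transpose_of_trivial, Function.comp_def] using this
  let d : Fin n → ℝ := fun i => (√|hH.eigenvalues i|)⁻¹
  refine ⟨p, hp, (U * diagonal d).submatrix id e, ?_⟩
  have h1 : ((U * diagonal d).submatrix id e)ᵀ * Q * (U * diagonal d).submatrix id e =
      (diagonal fun i => d i * hH.eigenvalues i * d i).submatrix e e := by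
    have h2 : (U * diagonal d)ᵀ * Q * (U * diagonal d) =
        diagonal fun i => d i * hH.eigenvalues i * d i := by
      rw [transpose_mul, diagonal_transpose,
        show diagonal d * Uᵀ * Q * (U * diagonal d) = diagonal d * (Uᵀ * Q * U) * diagonal d by
          simp only [Matrix.mul_assoc], hU, diagonal_mul_diagonal, diagonal_mul_diagonal]
    rw [← h2]
    ext i j
    simp [Matrix.mul_apply]
  rw [h1, submatrix_diagonal_equiv, diagonal_map (map_zero _), signatureMatrix]
  congr 1
  ext i
  have key : d (e i) * d (e i) = |hH.eigenvalues (e i)|⁻¹ := by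
    simp only [d]
    rw [← mul_inv, Real.mul_self_sqrt (abs_nonneg _)]
  have hd : d (e i) * hH.eigenvalues (e i) * d (e i) = if (i : ℕ) < p then 1 else -1 := by
    rw [mul_right_comm, key]
    have h0 := hne (e i)
    split_ifs with h
    · rw [abs_of_pos ((he i).2 h), inv_mul_cancel₀ h0]
    · rw [abs_of_neg (lt_of_le_of_ne (not_lt.1 fun h' => h ((he i).1 h')) h0)]
      field_simp
  simp only [Function.comp_apply, hd]
  split_ifs <;> simp

open scoped ComplexOrder in
/-- Hilbert 90 for the cocycle `A`, in explicit form. -/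
theorem exists_isUnit_mul_eq_map_star {n : ℕ} (A : Matrix (Fin n) (Fin n) ℂ)
    (hH : A.IsHermitian) (hc : A * A.map (star : ℂ → ℂ) = 1) :
    ∃ P : Matrix (Fin n) (Fin n) ℂ, IsUnit P ∧ A * P = P.map (star : ℂ → ℂ) := by
  have hB : (A.map (star : ℂ → ℂ)).IsHermitian := hH.map _ fun _ => rfl
  set B := A.map (star : ℂ → ℂ) with hBdef
  have hBA : B.map (star : ℂ → ℂ) = A := by ext; simp [B]
  refine ⟨(1 + Complex.I) • (1 : Matrix (Fin n) (Fin n) ℂ) + (1 - Complex.I) • B, ?_, ?_⟩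
  · have hpos : (1 + Bᴴ * B).PosDef :=
      PosDef.one.add_posSemidef (posSemidef_conjTranspose_mul_self B)
    have hprod : ((1 - Complex.I) • (1 : Matrix (Fin n) (Fin n) ℂ) + (1 + Complex.I) • B) *
        ((1 + Complex.I) • (1 : Matrix (Fin n) (Fin n) ℂ) + (1 - Complex.I) • B) =
        (2 : ℂ) • (1 + Bᴴ * B) := by
      rw [hB.eq]
      simp only [add_mul, mul_add, smul_mul_smul_comm, one_mul, mul_one]
      match_scalars <;> grind [Complex.I_sq]
    have hu : IsUnit ((2 : ℂ) • (1 + Bᴴ * B)) :=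
      (isUnit_smul_iff (Units.mk0 (2 : ℂ) two_ne_zero) _).2 hpos.isUnit
    rw [← hprod] at hu
    rw [isUnit_iff_isUnit_det, det_mul] at hu
    exact (isUnit_iff_isUnit_det _).2 (isUnit_of_mul_isUnit_right hu)
  · have : ((1 + Complex.I) • (1 : Matrix (Fin n) (Fin n) ℂ) + (1 - Complex.I) • B).map
        (star : ℂ → ℂ) = (1 - Complex.I) • 1 + (1 + Complex.I) • A := by
      rw [← hBA]
      ext i j
      simp [one_apply, apply_ite, sub_eq_add_neg]
    rw [this, mul_add, Matrix.mul_smul, Matrix.mul_smul, mul_one, hc, add_comm]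

theorem star_dotProduct_signatureMatrix_mulVec {n p : ℕ} (w : Fin n → ℂ) :
    star w ⬝ᵥ (signatureMatrix n p *ᵥ w) =
      ((∑ i : Fin n, (if (i : ℕ) < p then 1 else -1) * ‖w i‖ ^ 2 : ℝ) : ℂ) := by
  simp only [signatureMatrix, dotProduct, mulVec_diagonal, Complex.ofReal_sum]
  refine Finset.sum_congr rfl fun i _ => ?_
  have := Complex.conj_mul' (w i)
  split_ifs <;> simp [this]

/-- Half of Sylvester's law of inertia for complex Hermitian congruence. -/
theorem le_of_conjTranspose_mul_signatureMatrix_mul_eq {n p r : ℕ} (hr : r ≤ n)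
    {h k : Matrix (Fin n) (Fin n) ℂ} (hk : IsUnit k)
    (heq : hᴴ * signatureMatrix n p * h = kᴴ * signatureMatrix n r * k) : r ≤ p := by
  by_contra! hlt
  let T : Matrix (Fin n) (Fin n) ℂ := fun i =>
    if (i : ℕ) < p then h i else if r ≤ (i : ℕ) then k i else 0
  have hT : T.det = 0 := by
    refine det_eq_zero_of_row_eq_zero ⟨p, hlt.trans_le hr⟩ fun j => ?_
    simp [T, hlt.not_ge]
  obtain ⟨v, hv, hTv⟩ := exists_mulVec_eq_zero_iff.2 hT
  have hh (i : Fin n) (hi : (i : ℕ) < p) : (h *ᵥ v) i = 0 := by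
    have := congrFun hTv i
    simpa [T, mulVec, hi] using this
  have hkv (i : Fin n) (hi : r ≤ (i : ℕ)) : (k *ᵥ v) i = 0 := by
    have := congrFun hTv i
    simpa [T, mulVec, hi, (hlt.trans_le hi).not_gt] using this
  have form (g S : Matrix (Fin n) (Fin n) ℂ) :
      star v ⬝ᵥ ((gᴴ * S * g) *ᵥ v) = star (g *ᵥ v) ⬝ᵥ (S *ᵥ (g *ᵥ v)) := by
    rw [star_mulVec, ← dotProduct_mulVec, mulVec_mulVec, mulVec_mulVec, Matrix.mul_assoc]
  have hform := form h (signatureMatrix n p)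
  rw [heq, form, star_dotProduct_signatureMatrix_mulVec,
    star_dotProduct_signatureMatrix_mulVec] at hform
  have hreal := Complex.ofReal_injective hform
  have hle : ∑ i : Fin n, (if (i : ℕ) < p then (1 : ℝ) else -1) * ‖(h *ᵥ v) i‖ ^ 2 ≤ 0 := by
    refine Finset.sum_nonpos fun i _ => ?_
    split_ifs with hi
    · simp [hh i hi]
    · nlinarith [sq_nonneg ‖(h *ᵥ v) i‖]
  have hsum : ∑ i : Fin n, (if (i : ℕ) < r then (1 : ℝ) else -1) * ‖(k *ᵥ v) i‖ ^ 2 =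
      ∑ i : Fin n, ‖(k *ᵥ v) i‖ ^ 2 := by
    refine Finset.sum_congr rfl fun i _ => ?_
    split_ifs with hi
    · simp
    · simp [hkv i (not_lt.1 hi)]
  have hzero : ∑ i : Fin n, ‖(k *ᵥ v) i‖ ^ 2 = 0 :=
    le_antisymm (by rw [← hsum, hreal]; exact hle) (Finset.sum_nonneg fun i _ => sq_nonneg _)
  rw [Finset.sum_eq_zero_iff_of_nonneg fun i _ => sq_nonneg _] at hzero
  have hkz : k *ᵥ v = 0 := by
    ext i
    simpa using hzero i (Finset.mem_univ i)
  exact hv (mulVec_injective_of_isUnit hk (by rw [hkz, mulVec_zero]))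

theorem eq_conjTranspose_mul_mul_of_twisted_conj {n : ℕ} {A h S : Matrix (Fin n) (Fin n) ℂ}
    (hh : hᵀ * h = 1) (hS : h.map (star : ℂ → ℂ) * A * h⁻¹ = S) : A = hᴴ * S * h := by
  have h1 : hᴴ * h.map (star : ℂ → ℂ) = 1 := by
    have := congrArg (fun M : Matrix (Fin n) (Fin n) ℂ => M.map (starRingEnd ℂ)) hh
    rw [Matrix.map_mul, Matrix.map_one _ (map_zero _) (map_one _)] at this
    exact this
  rw [← hS, inv_eq_left_inv hh, ← Matrix.mul_assoc, ← Matrix.mul_assoc, h1, Matrix.one_mul,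
    Matrix.mul_assoc, hh, Matrix.mul_one]

theorem exists_twisted_conj_eq_signatureMatrix {n : ℕ} (A : Matrix (Fin n) (Fin n) ℂ)
    (hA : Aᵀ * A = 1) (hc : A * A.map (star : ℂ → ℂ) = 1) :
    ∃ p ≤ n, ∃ h : Matrix (Fin n) (Fin n) ℂ, hᵀ * h = 1 ∧
      h.map (star : ℂ → ℂ) * A * h⁻¹ = signatureMatrix n p := by
  have hAt : Aᵀ = A.map (star : ℂ → ℂ) := left_inv_eq_right_inv hA hc
  have hH : A.IsHermitian := by
    rw [IsHermitian, conjTranspose, hAt]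
    ext; simp
  obtain ⟨P, hP, hAP⟩ := exists_isUnit_mul_eq_map_star A hH hc
  have hreal : (Pᵀ * P).map (star : ℂ → ℂ) = Pᵀ * P := by
    have : (Pᵀ * P).map (star : ℂ → ℂ) = (P.map star)ᵀ * P.map star := by
      change (Pᵀ * P).map (starRingEnd ℂ) = _
      rw [Matrix.map_mul]; rfl
    rw [this, ← hAP, transpose_mul, Matrix.mul_assoc, ← Matrix.mul_assoc Aᵀ, hA, Matrix.one_mul]
  let Q : Matrix (Fin n) (Fin n) ℝ := (Pᵀ * P).map Complex.re
  have hQ : Q.map (algebraMap ℝ ℂ) = Pᵀ * P := by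
    ext i j
    exact Complex.conj_eq_iff_re.1 (congrFun (congrFun hreal i) j)
  have hQt : Qᵀ = Q := by
    rw [← transpose_map, transpose_mul, transpose_transpose]
  have hQu : IsUnit Q := by
    have h1 : IsUnit (Pᵀ * P) := ((isUnit_transpose P).2 hP).mul hP
    rw [← hQ, isUnit_iff_isUnit_det, ← RingHom.mapMatrix_apply, ← RingHom.map_det,
      isUnit_iff_ne_zero] at h1
    rw [isUnit_iff_isUnit_det, isUnit_iff_ne_zero]
    exact fun h0 => h1 (by rw [h0, map_zero])
  obtain ⟨p, hp, R, hR⟩ := exists_congr_signatureMatrix Q hQt hQu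
  let D : Fin n → ℂ := fun i => if (i : ℕ) < p then 1 else Complex.I
  let R' := R.map (algebraMap ℝ ℂ)
  have hR' : R'.map (star : ℂ → ℂ) = R' := by
    ext i j; simp [R']
  have hS : R'ᵀ * (Pᵀ * P) * R' = signatureMatrix n p := by
    rw [← hR, Matrix.map_mul, Matrix.map_mul, hQ]; rfl
  let g := P * R' * diagonal D
  have hg : gᵀ * g = 1 := by
    have : gᵀ * g = diagonal D * (R'ᵀ * (Pᵀ * P) * R') * diagonal D := by
      simp only [g, transpose_mul, diagonal_transpose, Matrix.mul_assoc]
    rw [this, hS, signatureMatrix, diagonal_mul_diagonal, diagonal_mul_diagonal, ← diagonal_one]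
    congr 1
    ext i
    by_cases hi : (i : ℕ) < p <;> simp [D, hi]
  have hg' : g * gᵀ = 1 := mul_eq_one_comm.1 hg
  refine ⟨p, hp, gᵀ, by simpa using hg', ?_⟩
  have hginv : (gᵀ)⁻¹ = g := inv_eq_left_inv hg'
  have hgs : gᵀ.map (star : ℂ → ℂ) = diagonal (star D) * (R'ᵀ * (P.map (star : ℂ → ℂ))ᵀ) := by
    have : g.map (star : ℂ → ℂ) = P.map star * R' * diagonal (star D) := by
      conv_rhs => rw [← hR']
      change (P * R' * diagonal D).map (starRingEnd ℂ) = _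
      rw [Matrix.map_mul, Matrix.map_mul, diagonal_map (map_zero _)]; rfl
    rw [transpose_map, this, transpose_mul, transpose_mul, diagonal_transpose]
  rw [hginv, hgs, ← hAP, transpose_mul]
  have : diagonal (star D) * (R'ᵀ * (Pᵀ * Aᵀ)) * A * g =
      diagonal (star D) * (R'ᵀ * (Pᵀ * (Aᵀ * A) * P) * R') * diagonal D := by
    simp only [g, Matrix.mul_assoc]
  rw [this, hA, Matrix.mul_one, hS, signatureMatrix, diagonal_mul_diagonal, diagonal_mul_diagonal]
  congr 1
  ext i
  by_cases hi : (i : ℕ) < p <;> simp [D, hi]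

/-- Let `n ≥ 1` and `O(n,ℂ) = {A | Aᵀ A = 1}`. For every
`A ∈ O(n,ℂ)` with `A · conj(A) = 1` (a Galois 1-cocycle), there is a unique pair
`(p, q)` with `p + q = n` such that `conj(h) · A · h⁻¹ = diag(1_p, −1_q)` for some
`h ∈ O(n,ℂ)`; moreover each `diag(1_p, −1_q)` is itself such a cocycle, so these
matrices represent bijectively the orbits of the twisted conjugation action
`h • A = conj(h) · A · h⁻¹` on the set of cocycles. -/
theorem orthogonal_cocycle_classification (n : ℕ) (hn : 1 ≤ n) :
    (∀ A : Matrix (Fin n) (Fin n) ℂ, Aᵀ * A = 1 → A * A.map (star : ℂ → ℂ) = 1 →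
      ∃! pq : ℕ × ℕ, pq.1 + pq.2 = n ∧
        ∃ h : Matrix (Fin n) (Fin n) ℂ, hᵀ * h = 1 ∧
          (h.map (star : ℂ → ℂ)) * A * h⁻¹ = signatureMatrix n pq.1) ∧
    (∀ p q : ℕ, p + q = n →
      (signatureMatrix n p)ᵀ * signatureMatrix n p = 1 ∧
      signatureMatrix n p * (signatureMatrix n p).map (star : ℂ → ℂ) = 1) := by
  refine ⟨fun A hA hc => ?_, fun p q _ => ?_⟩
  · obtain ⟨p, hp, h, hh, hS⟩ := exists_twisted_conj_eq_signatureMatrix A hA hc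
    refine ⟨(p, n - p), ⟨Nat.add_sub_cancel' hp, h, hh, hS⟩, ?_⟩
    rintro ⟨r, s⟩ ⟨hrs, k, hk, hkS⟩
    have e : hᴴ * signatureMatrix n p * h = kᴴ * signatureMatrix n r * k :=
      (eq_conjTranspose_mul_mul_of_twisted_conj hh hS).symm.trans
        (eq_conjTranspose_mul_mul_of_twisted_conj hk hkS)
    have h1 := le_of_conjTranspose_mul_signatureMatrix_mul_eq (by dsimp at hrs; omega)
      (.of_mul_eq_one_right _ hk) e
    have h2 := le_of_conjTranspose_mul_signatureMatrix_mul_eq hp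
      (.of_mul_eq_one_right _ hh) e.symm
    ext <;> dsimp at * <;> omega
  · constructor
    · rw [signatureMatrix, diagonal_transpose, diagonal_mul_diagonal, ← diagonal_one]
      congr 1
      ext i
      split_ifs <;> simp
    · rw [signatureMatrix, diagonal_map (star_zero _), diagonal_mul_diagonal, ← diagonal_one]
      congr 1
      ext i
      by_cases hi : (i : ℕ) < p <;> simp [hi]
end
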